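/- arXiv:1209.0501 — 2 statements merged into one kernel-verified Lean document; each statement's English description precedes it below -/
import Mathlib

section
/- Let Y be an infinite-dimensional Banach space such that Y* is separable and Y has property (M). Then for every u in the unit sphere of Y, every t ∈ (0,1] and every η > 0, there exists a 2-basic sequence (eₙ) in the unit sphere of Y such that for each n, ‖u ± t·eₙ‖ ≤ 1 + δ̄_Y(t) + η. -/
open Set Metric Filter Topology

noncomputable section

/-- `T` is a uniform quotient map on `S`: uniformly continuous and co-uniformly
continuous (with closed balls). -/
def UniformQuotientOn {X Y : Type*} [NormedAddCommGroup X] [NormedAddCommGroup Y]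
    (T : X → Y) (S : Set X) : Prop :=
  (∀ ε > 0, ∃ δ > 0, ∀ x ∈ S, ∀ x' ∈ S, ‖x - x'‖ ≤ δ → ‖T x - T x'‖ ≤ ε) ∧
  (∀ ε > 0, ∃ δ > 0, ∀ x ∈ S, closedBall (T x) δ ⊆ T '' (closedBall x ε ∩ S))

/-- The set of ratios `‖Tx - Tx'‖ / ‖x - x'‖` over pairs of points of `S` at distance `≥ d`. -/
def LargeDistRatioSet {X Y : Type*} [NormedAddCommGroup X] [NormedAddCommGroup Y]
    (T : X → Y) (S : Set X) (d : ℝ) : Set ℝ :=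
  {r | ∃ x ∈ S, ∃ x' ∈ S, d ≤ ‖x - x'‖ ∧ r = ‖T x - T x'‖ / ‖x - x'‖}

/-- `L_d^T`, the Lipschitz constant of `T` for distances `≥ d`. -/
noncomputable def Ld {X Y : Type*} [NormedAddCommGroup X] [NormedAddCommGroup Y]
    (T : X → Y) (S : Set X) (d : ℝ) : ℝ :=
  sSup (LargeDistRatioSet T S d)

/-- `T` is Lipschitz for large distances: `L_d^T < ∞` for every `d > 0`. -/
def LipschitzLargeDist {X Y : Type*} [NormedAddCommGroup X] [NormedAddCommGroup Y]
    (T : X → Y) (S : Set X) : Prop :=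
  ∀ d > 0, BddAbove (LargeDistRatioSet T S d)

/-- The set of co-Lipschitz constants valid for all radii `r ≥ d`. -/
def CoLipSet {X Y : Type*} [NormedAddCommGroup X] [NormedAddCommGroup Y]
    (T : X → Y) (S : Set X) (d : ℝ) : Set ℝ :=
  {c | 0 < c ∧ ∀ r, d ≤ r → ∀ x ∈ S, ∀ y : Y, ‖y - T x‖ < c * r →
      y ∈ T '' (closedBall x r ∩ S)}

/-- `c_d^T`. -/
noncomputable def cdT {X Y : Type*} [NormedAddCommGroup X] [NormedAddCommGroup Y]
    (T : X → Y) (S : Set X) (d : ℝ) : ℝ :=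
  sSup (CoLipSet T S d)

/-- `C^T = lim_{d → ∞} c_d^T` (the limit of the nondecreasing family `c_d^T`,
i.e. its supremum). -/
noncomputable def CT {X Y : Type*} [NormedAddCommGroup X] [NormedAddCommGroup Y]
    (T : X → Y) (S : Set X) : ℝ :=
  sSup {c | ∃ d, 0 < d ∧ c = cdT T S d}

/-- The set of admissible `δ`'s in the definition of the modulus `β̄_X(t)`. -/
def betaModSet (X : Type*) [NormedAddCommGroup X] (t : ℝ) : Set ℝ :=
  {δ | 0 ≤ δ ∧ ∀ x ∈ closedBall (0 : X) 1, ∀ xs : ℕ → X,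
      (∀ n, xs n ∈ closedBall (0 : X) 1) →
      (∀ m n, m ≠ n → t ≤ ‖xs m - xs n‖) →
      ∃ n, ‖x - xs n‖ / 2 ≤ 1 - δ}

/-- The modulus `β̄_X(t)` of property (β) of Rolewicz. -/
noncomputable def betaMod (X : Type*) [NormedAddCommGroup X] (t : ℝ) : ℝ :=
  sSup (betaModSet X t)

/-- Property (β) of Rolewicz. -/
def PropertyBeta (X : Type*) [NormedAddCommGroup X] : Prop :=
  ∃ a, 1 ≤ a ∧ a ≤ 2 ∧ ∀ t, 0 < t → t ≤ a → ∃ δ, 0 < δ ∧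
    ∀ x ∈ closedBall (0 : X) 1, ∀ xs : ℕ → X,
      (∀ n, xs n ∈ closedBall (0 : X) 1) →
      (∀ m n, m ≠ n → t ≤ ‖xs m - xs n‖) →
      ∃ n, ‖x - xs n‖ / 2 ≤ 1 - δ

/-- `Z` is a closed subspace of finite codimension. -/
def FinCodim {Y : Type*} [NormedAddCommGroup Y] [NormedSpace ℝ Y] (Z : Subspace ℝ Y) : Prop :=
  IsClosed (Z : Set Y) ∧ FiniteDimensional ℝ (Y ⧸ Z)

/-- `ρ̄_Y(t, y) = inf_Z sup_{z ∈ S_Z} (‖y + tz‖ - 1)`. -/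
noncomputable def rhoAt {Y : Type*} [NormedAddCommGroup Y] [NormedSpace ℝ Y]
    (t : ℝ) (y : Y) : ℝ :=
  sInf {s | ∃ Z : Subspace ℝ Y, FinCodim Z ∧
    s = sSup {r | ∃ z ∈ Z, ‖z‖ = 1 ∧ r = ‖y + t • z‖ - 1}}

/-- The modulus of asymptotic uniform smoothness `ρ̄_Y(t)`. -/
noncomputable def rhoMod (Y : Type*) [NormedAddCommGroup Y] [NormedSpace ℝ Y] (t : ℝ) : ℝ :=
  sSup {r | ∃ y : Y, ‖y‖ = 1 ∧ r = rhoAt t y}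

/-- `δ̄_Y(t, y) = sup_Z inf_{z ∈ S_Z} (‖y + tz‖ - 1)`. -/
noncomputable def deltaAt {Y : Type*} [NormedAddCommGroup Y] [NormedSpace ℝ Y]
    (t : ℝ) (y : Y) : ℝ :=
  sSup {s | ∃ Z : Subspace ℝ Y, FinCodim Z ∧
    s = sInf {r | ∃ z ∈ Z, ‖z‖ = 1 ∧ r = ‖y + t • z‖ - 1}}

/-- The modulus of asymptotic uniform convexity `δ̄_Y(t)`. -/
noncomputable def deltaMod (Y : Type*) [NormedAddCommGroup Y] [NormedSpace ℝ Y] (t : ℝ) : ℝ :=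
  sInf {r | ∃ y : Y, ‖y‖ = 1 ∧ r = deltaAt t y}

/-- The norm of `Y` is asymptotically uniformly smooth. -/
def AUS (Y : Type*) [NormedAddCommGroup Y] [NormedSpace ℝ Y] : Prop :=
  Tendsto (fun t => rhoMod Y t / t) (𝓝[>] 0) (𝓝 0)

/-- The norm of `Y` is asymptotically uniformly convex. -/
def AUC (Y : Type*) [NormedAddCommGroup Y] [NormedSpace ℝ Y] : Prop :=
  ∀ t > 0, 0 < deltaMod Y t

/-- A sequence is basic with basis constant at most `K`. -/
def IsBasicWithConst {Y : Type*} [NormedAddCommGroup Y] [NormedSpace ℝ Y]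
    (K : ℝ) (e : ℕ → Y) : Prop :=
  ∀ (a : ℕ → ℝ) (m n : ℕ), m ≤ n →
    ‖∑ i ∈ Finset.range m, a i • e i‖ ≤ K * ‖∑ i ∈ Finset.range n, a i • e i‖

/-- A weakly null sequence. -/
def WeaklyNull {Y : Type*} [NormedAddCommGroup Y] [NormedSpace ℝ Y] (xs : ℕ → Y) : Prop :=
  ∀ f : Y →L[ℝ] ℝ, Tendsto (fun n => f (xs n)) atTop (𝓝 0)

/-- Property (M) of Kalton. -/
def PropertyM (Y : Type*) [NormedAddCommGroup Y] [NormedSpace ℝ Y] : Prop :=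
  ∀ u v : Y, ‖u‖ = 1 → ‖v‖ = 1 → ∀ xs : ℕ → Y, WeaklyNull xs →
    limsup (fun n => ‖u + xs n‖) atTop = limsup (fun n => ‖v + xs n‖) atTop

/-- `N` is a norm on `X` equivalent to the given one. -/
def IsEquivNorm {X : Type*} [NormedAddCommGroup X] [NormedSpace ℝ X] (N : X → ℝ) : Prop :=
  (∀ x y, N (x + y) ≤ N x + N y) ∧
  (∀ (a : ℝ) (x : X), N (a • x) = |a| * N x) ∧
  (∃ c > 0, ∃ C > 0, ∀ x : X, c * ‖x‖ ≤ N x ∧ N x ≤ C * ‖x‖)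

/-- The norm `N` has property (β) of Rolewicz. -/
def NormHasPropertyBeta {X : Type*} [NormedAddCommGroup X] (N : X → ℝ) : Prop :=
  ∃ a, 1 ≤ a ∧ a ≤ 2 ∧ ∀ t, 0 < t → t ≤ a → ∃ δ, 0 < δ ∧
    ∀ x : X, N x ≤ 1 → ∀ xs : ℕ → X, (∀ n, N (xs n) ≤ 1) →
      (∀ m n, m ≠ n → t ≤ N (xs m - xs n)) →
      ∃ n, N (x - xs n) / 2 ≤ 1 - δ

lemma finCodim_ker_pi {Y : Type*} [NormedAddCommGroup Y] [NormedSpace ℝ Y] {ι : Type*} [Finite ι]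
    (f : ι → StrongDual ℝ Y) : FinCodim (LinearMap.ker (ContinuousLinearMap.pi f).toLinearMap) := by
  refine ⟨(ContinuousLinearMap.pi f).isClosed_ker, ?_⟩
  exact Module.Finite.equiv (LinearMap.quotKerEquivRange (ContinuousLinearMap.pi f).toLinearMap).symm

lemma FinCodim.exists_norm_eq_one {Y : Type*} [NormedAddCommGroup Y] [NormedSpace ℝ Y]
    (hY : ¬ FiniteDimensional ℝ Y) {Z : Subspace ℝ Y} (hZ : FinCodim Z) :
    ∃ z ∈ Z, ‖z‖ = 1 := by
  have hne : Z ≠ ⊥ := by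
    rintro rfl
    have := hZ.2
    exact hY (Module.Finite.equiv (Submodule.quotEquivOfEqBot (⊥ : Subspace ℝ Y) rfl))
  obtain ⟨z, hz, hz0⟩ := Submodule.exists_mem_ne_zero_of_ne_bot hne
  refine ⟨‖z‖⁻¹ • z, Z.smul_mem _ hz, ?_⟩
  rw [norm_smul, norm_inv, norm_norm, inv_mul_cancel₀ (norm_ne_zero_iff.2 hz0)]

/-- Every closed subspace of finite codimension contains unit vectors that almost realize
`δ̄_Y(t, v)` from above. -/
lemma FinCodim.exists_norm_add_smul_lt {Y : Type*} [NormedAddCommGroup Y] [NormedSpace ℝ Y]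
    (hY : ¬ FiniteDimensional ℝ Y) {Z : Subspace ℝ Y} (hZ : FinCodim Z) {v : Y} (hv : ‖v‖ = 1)
    {t c : ℝ} (ht : 0 ≤ t) (hc : deltaAt t v < c) :
    ∃ z ∈ Z, ‖z‖ = 1 ∧ ‖v + t • z‖ < 1 + c := by
  have hle : sInf {r | ∃ z ∈ Z, ‖z‖ = 1 ∧ r = ‖v + t • z‖ - 1} ≤ deltaAt t v := by
    refine le_csSup ⟨t, ?_⟩ ⟨Z, hZ, rfl⟩
    rintro s ⟨W, -, rfl⟩
    rcases Set.eq_empty_or_nonempty {r | ∃ z ∈ W, ‖z‖ = 1 ∧ r = ‖v + t • z‖ - 1} with h | h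
    · rw [h, Real.sInf_empty]
      exact ht
    · obtain ⟨r, hr⟩ := h
      have hbdd : BddBelow {r | ∃ z ∈ W, ‖z‖ = 1 ∧ r = ‖v + t • z‖ - 1} := by
        refine ⟨-1, ?_⟩
        rintro _ ⟨z, -, -, rfl⟩
        linarith [norm_nonneg (v + t • z)]
      refine (csInf_le hbdd hr).trans ?_
      obtain ⟨z, -, hz, rfl⟩ := hr
      have h1 := norm_add_le v (t • z)
      rw [norm_smul, hz, hv, Real.norm_of_nonneg ht] at h1
      linarith
  obtain ⟨z₀, hz₀, hz₁⟩ := hZ.exists_norm_eq_one hY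
  obtain ⟨_, ⟨z, hz, hz1, rfl⟩, hlt⟩ := exists_lt_of_csInf_lt
    (s := {r | ∃ z ∈ Z, ‖z‖ = 1 ∧ r = ‖v + t • z‖ - 1}) ⟨_, z₀, hz₀, hz₁, rfl⟩ (hle.trans_lt hc)
  exact ⟨z, hz, hz1, by linarith⟩

/-- A bounded sequence on which each member of a dense sequence of functionals eventually vanishes
is weakly null. -/
lemma weaklyNull_of_denseRange {Y : Type*} [NormedAddCommGroup Y] [NormedSpace ℝ Y]
    {f : ℕ → StrongDual ℝ Y} (hf : DenseRange f) {z : ℕ → Y} (hz : ∀ n, ‖z n‖ = 1)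
    (hfz : ∀ n, ∀ k ≤ n, f k (z n) = 0) : WeaklyNull z := by
  intro g
  rw [Metric.tendsto_atTop]
  intro ε hε
  obtain ⟨k, hk⟩ := hf.exists_dist_lt g hε
  refine ⟨k, fun n hn => ?_⟩
  have h1 : g (z n) = (g - f k) (z n) := by
    rw [_root_.sub_apply, hfz n k hn, sub_zero]
  rw [dist_zero_right, h1]
  refine ((g - f k).le_opNorm (z n)).trans_lt ?_
  rwa [hz n, mul_one, ← dist_eq_norm]

lemma WeaklyNull.const_smul {Y : Type*} [NormedAddCommGroup Y] [NormedSpace ℝ Y]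
    {z : ℕ → Y} (hz : WeaklyNull z) (t : ℝ) : WeaklyNull fun n => t • z n := by
  intro f
  simpa using (hz f).const_mul t

lemma PropertyM.eventually_norm_add_lt {Y : Type*} [NormedAddCommGroup Y] [NormedSpace ℝ Y]
    (hM : PropertyM Y) {u v : Y} (hu : ‖u‖ = 1) (hv : ‖v‖ = 1) {x : ℕ → Y} (hx : WeaklyNull x)
    {B : ℝ} (hB : ∀ n, ‖x n‖ ≤ B) {c d : ℝ} (hvx : ∀ n, ‖v + x n‖ ≤ c) (hcd : c < d) :
    ∀ᶠ n in atTop, ‖u + x n‖ < d := by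
  refine eventually_lt_of_limsup_lt ?_ ?_
  · rw [hM u v hu hv x hx]
    refine (limsup_le_of_le ?_ (Eventually.of_forall hvx)).trans_lt hcd
    exact IsBoundedUnder.isCoboundedUnder_le
      (isBoundedUnder_of ⟨0, fun n => norm_nonneg (v + x n)⟩)
  · refine isBoundedUnder_of ⟨1 + B, fun n => (norm_add_le _ _).trans ?_⟩
    rw [hu]
    linarith [hB n]

/-- Mazur's lemma: a normalized weakly null sequence is eventually almost orthogonal to a given
finite-dimensional subspace. -/
lemma WeaklyNull.eventually_norm_le_mul_norm_add {Y : Type*} [NormedAddCommGroup Y]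
    [NormedSpace ℝ Y] {z : ℕ → Y} (hz : WeaklyNull z) (hz1 : ∀ n, ‖z n‖ = 1)
    (F : Subspace ℝ Y) [FiniteDimensional ℝ F] {q : ℝ} (hq : 1 < q) :
    ∀ᶠ n in atTop, ∀ x ∈ F, ∀ a : ℝ, ‖x‖ ≤ q * ‖x + a • z n‖ := by
  have hK : IsCompact ((↑) '' sphere (0 : F) 1 : Set Y) :=
    (isCompact_sphere (0 : F) 1).image continuous_subtype_val
  have hq0 : 0 < q := by linarith
  obtain ⟨ε, hε, hεq⟩ : ∃ ε > 0, q * (1 - 3 * ε) = 1 := by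
    refine ⟨(1 - q⁻¹) / 3, ?_, by field_simp; ring⟩
    have := inv_lt_one_of_one_lt₀ hq
    linarith
  choose! g hg1 hgx using fun (x : Y) (hx : x ≠ 0) => exists_dual_vector ℝ x (norm_ne_zero_iff.2 hx)
  have hK0 : ∀ x ∈ ((↑) '' sphere (0 : F) 1 : Set Y), ‖x‖ = 1 := by
    rintro _ ⟨x, hx, rfl⟩
    simpa using hx
  have hne : ∀ x : Y, ‖x‖ = 1 → x ≠ 0 := fun x hx => norm_ne_zero_iff.1 (by simp [hx])
  obtain ⟨T, hTK, hT⟩ := hK.elim_nhds_subcover (fun x => {y | 1 - ε < g x y}) fun x hx => by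
    refine (isOpen_lt continuous_const (g x).continuous).mem_nhds ?_
    have h1 := hgx x (hne x (hK0 x hx))
    rw [hK0 x hx] at h1
    simp only [Set.mem_ofPred_eq, h1, RCLike.ofReal_real_eq_id, id]
    linarith
  have hev : ∀ᶠ n in atTop, ∀ x ∈ T, |g x (z n)| < ε := by
    rw [Filter.eventually_all_finset]
    intro x _
    have := (hz (g x)).abs
    rw [abs_zero] at this
    exact this.eventually_lt_const hε
  filter_upwards [hev] with n hn
  have hunit : ∀ y ∈ F, ‖y‖ = 1 → ∀ a : ℝ, 1 ≤ q * ‖y + a • z n‖ := by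
    intro y hy hy1 a
    have hyK : y ∈ ((↑) '' sphere (0 : F) 1 : Set Y) := ⟨⟨y, hy⟩, by simpa using hy1, rfl⟩
    rcases le_total 2 |a| with ha | ha
    · have h1 := norm_sub_le (y + a • z n) y
      rw [add_sub_cancel_left, norm_smul, hz1, Real.norm_eq_abs, hy1] at h1
      nlinarith
    · obtain ⟨x, hxT, hx⟩ := Set.mem_iUnion₂.1 (hT hyK)
      have hx' : 1 - ε < g x y := hx
      have h1 : |a * g x (z n)| ≤ 2 * ε := by
        rw [abs_mul]
        exact mul_le_mul ha (hn x hxT).le (abs_nonneg _) (by norm_num)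
      have h2 : g x (y + a • z n) ≤ ‖y + a • z n‖ := by
        have h3 := (g x).le_opNorm (y + a • z n)
        rw [hg1 x (hne x (hK0 x (hTK x hxT))), one_mul] at h3
        exact (le_abs_self _).trans h3
      rw [map_add, map_smul, smul_eq_mul] at h2
      rw [← hεq]
      refine mul_le_mul_of_nonneg_left ?_ hq0.le
      linarith [neg_abs_le (a * g x (z n))]
  intro x hx a
  rcases eq_or_ne x 0 with rfl | hx0
  · rw [norm_zero]
    positivity
  have hpos : 0 < ‖x‖ := norm_pos_iff.2 hx0
  have h1 := hunit (‖x‖⁻¹ • x) (F.smul_mem _ hx)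
    (by rw [norm_smul, norm_inv, norm_norm, inv_mul_cancel₀ hpos.ne']) (‖x‖⁻¹ * a)
  rw [mul_smul, ← smul_add, norm_smul, norm_inv, norm_norm] at h1
  calc ‖x‖ = ‖x‖ * 1 := (mul_one _).symm
    _ ≤ ‖x‖ * (q * (‖x‖⁻¹ * ‖x + a • z n‖)) := mul_le_mul_of_nonneg_left h1 hpos.le
    _ = q * ‖x + a • z n‖ := by field_simp

lemma exists_two_basic {Y : Type*} [NormedAddCommGroup Y] [NormedSpace ℝ Y] {p : Y → Prop}
    (hp : ∀ (F : Subspace ℝ Y) [FiniteDimensional ℝ F] (q : ℝ), 1 < q →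
      ∃ y, p y ∧ ∀ x ∈ F, ∀ a : ℝ, ‖x‖ ≤ q * ‖x + a • y‖) :
    ∃ e : ℕ → Y, (∀ n, p (e n)) ∧ IsBasicWithConst 2 e := by
  classical
  let c : ℕ → ℝ := fun n => 2 - (1 / 2) ^ n
  have hc1 : ∀ n, 1 ≤ c n := fun n => by
    have := pow_le_one₀ (n := n) (by norm_num : (0 : ℝ) ≤ 1 / 2) (by norm_num)
    simp only [c]
    linarith
  have hc2 : ∀ n, c n ≤ 2 := fun n => by
    have := pow_pos (by norm_num : (0 : ℝ) < 1 / 2) n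
    simp only [c]
    linarith
  have hcs : ∀ n, 1 < c (n + 1) / c n := fun n => by
    rw [one_lt_div (by linarith [hc1 n])]
    have := pow_pos (by norm_num : (0 : ℝ) < 1 / 2) n
    simp only [c, pow_succ]
    linarith
  choose g hgp hg using fun (S : Finset Y) (n : ℕ) =>
    hp (Submodule.span ℝ (S : Set Y)) (c (n + 1) / c n) (hcs n)
  obtain ⟨S, hS⟩ : ∃ S : ℕ → Finset Y, ∀ n, S (n + 1) = insert (g (S n) n) (S n) :=
    ⟨fun n => Nat.rec ∅ (fun n T => insert (g T n) T) n, fun _ => rfl⟩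
  let e : ℕ → Y := fun n => g (S n) n
  have hmono : Monotone S := monotone_nat_of_le_succ fun n => by
    rw [hS]
    exact Finset.subset_insert _ _
  refine ⟨e, fun n => hgp _ _, fun a m n hmn => ?_⟩
  have hinc : Monotone fun n => c n * ‖∑ i ∈ Finset.range n, a i • e i‖ := by
    refine monotone_nat_of_le_succ fun n => ?_
    have hmem : ∑ i ∈ Finset.range n, a i • e i ∈ Submodule.span ℝ (S n : Set Y) := by
      refine Submodule.sum_mem _ fun i hi => Submodule.smul_mem _ _ (Submodule.subset_span ?_)
      have : e i ∈ S (i + 1) := by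
        rw [hS]
        exact Finset.mem_insert_self _ _
      exact hmono (Finset.mem_range.1 hi) this
    have h1 := hg (S n) n _ hmem (a n)
    have hpos : 0 < c n := by linarith [hc1 n]
    rw [Finset.sum_range_succ]
    rw [div_mul_eq_mul_div, le_div_iff₀ hpos, mul_comm] at h1
    exact h1
  calc ‖∑ i ∈ Finset.range m, a i • e i‖ ≤ c m * ‖∑ i ∈ Finset.range m, a i • e i‖ :=
        le_mul_of_one_le_left (norm_nonneg _) (hc1 m)
    _ ≤ c n * ‖∑ i ∈ Finset.range n, a i • e i‖ := hinc hmn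
    _ ≤ 2 * ‖∑ i ∈ Finset.range n, a i • e i‖ :=
        mul_le_mul_of_nonneg_right (hc2 n) (norm_nonneg _)

/-- Lemma `g_lem2_cont`: if moreover `Y*` is separable and `Y`
has property (M), one gets a 2-basic sequence with two-sided estimates against
`δ̄_Y(t)`. -/
theorem stmt14 {Y : Type*} [NormedAddCommGroup Y] [NormedSpace ℝ Y] [CompleteSpace Y]
    [TopologicalSpace.SeparableSpace (StrongDual ℝ Y)]
    (hY : ¬ FiniteDimensional ℝ Y) (hM : PropertyM Y)
    (u : Y) (hu : ‖u‖ = 1) (t : ℝ) (ht0 : 0 < t) (ht1 : t ≤ 1) (η : ℝ) (hη : 0 < η) :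
    ∃ e : ℕ → Y, (∀ n, ‖e n‖ = 1) ∧ IsBasicWithConst 2 e ∧
      ∀ n, ‖u + t • e n‖ ≤ 1 + deltaMod Y t + η ∧ ‖u - t • e n‖ ≤ 1 + deltaMod Y t + η := by
  obtain ⟨_, ⟨v, hv, rfl⟩, hlt⟩ := exists_lt_of_csInf_lt
    (s := {r | ∃ y : Y, ‖y‖ = 1 ∧ r = deltaAt t y}) ⟨_, u, hu, rfl⟩
    (show deltaMod Y t < deltaMod Y t + η / 2 by linarith)
  let f : ℕ → StrongDual ℝ Y := TopologicalSpace.denseSeq (StrongDual ℝ Y)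
  choose z hzZ hz1 hzv using fun n : ℕ =>
    (finCodim_ker_pi fun i : Fin (n + 1) => f i).exists_norm_add_smul_lt hY hv ht0.le hlt
  have hnull : WeaklyNull z := by
    refine weaklyNull_of_denseRange (TopologicalSpace.denseRange_denseSeq _) hz1 fun n k hk => ?_
    exact congrFun (LinearMap.mem_ker.1 (hzZ n)) ⟨k, Nat.lt_succ_of_le hk⟩
  have hbound : ∀ n, ‖t • z n‖ ≤ t := fun n => by
    rw [norm_smul, hz1, mul_one, Real.norm_of_nonneg ht0.le]
  have hclose : ∀ w : Y, ‖w‖ = 1 → ∀ᶠ n in atTop, ‖w + t • z n‖ < 1 + deltaMod Y t + η :=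
    fun w hw => hM.eventually_norm_add_lt hw hv (hnull.const_smul t) hbound
      (fun n => (hzv n).le) (by linarith)
  obtain ⟨e, he, hbasic⟩ := exists_two_basic (Y := Y) (p := fun y => ‖y‖ = 1 ∧
      ‖u + t • y‖ ≤ 1 + deltaMod Y t + η ∧ ‖u - t • y‖ ≤ 1 + deltaMod Y t + η) (by
    intro F _ q hq
    obtain ⟨n, hn, hplus, hminus⟩ := ((hnull.eventually_norm_le_mul_norm_add hz1 F hq).and
      ((hclose u hu).and (hclose (-u) (by rwa [norm_neg])))).exists
    refine ⟨z n, ⟨hz1 n, hplus.le, ?_⟩, hn⟩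
    rw [← norm_neg, neg_sub', sub_neg_eq_add]
    exact hminus.le)
  exact ⟨e, fun n => (he n).1, hbasic, fun n => (he n).2⟩

end
end

section
/- Let Y be a Banach space with separable dual. Then for every ε > 0 and every 0 < r ≤ 1, σ′_ε(rB_Y) ⊆ (1 − (1/2)·δ̄_Y(ε/2))·rB_Y, where B_Y is the closed unit ball of Y. -/
open Set Metric Filter Topology

noncomputable section

open Pointwise in
/-- `U` is weakly open in `Y`: every point has a basic weak neighborhood
(finitely many functionals) inside `U`. -/
def WeaklyOpen {Y : Type*} [NormedAddCommGroup Y] [NormedSpace ℝ Y] (U : Set Y) : Prop :=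
  ∀ y ∈ U, ∃ (k : ℕ) (f : Fin k → (Y →L[ℝ] ℝ)) (δ : ℝ), 0 < δ ∧
    {z : Y | ∀ i, |f i z - f i y| < δ} ⊆ U

/-- The "Szlenk type" derivation `σ'_ε`: remove from `F` the union of all relatively
weakly open subsets of `F` of norm-diameter at most `ε`. -/
def sigmaPrime {Y : Type*} [NormedAddCommGroup Y] [NormedSpace ℝ Y]
    (ε : ℝ) (F : Set Y) : Set Y :=
  F \ ⋃₀ {V : Set Y | (∃ U : Set Y, WeaklyOpen U ∧ V = U ∩ F) ∧ Metric.diam V ≤ ε}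

/-- Small coordinates of `v` modulo a closed subspace of finite codimension put `v` near it. -/
theorem FinCodim.exists_functionals_near {Y : Type*} [NormedAddCommGroup Y] [NormedSpace ℝ Y]
    {Z : Subspace ℝ Y} (hZ : FinCodim Z) {η : ℝ} (hη : 0 < η) :
    ∃ (k : ℕ) (f : Fin k → (Y →L[ℝ] ℝ)) (d : ℝ), 0 < d ∧
      ∀ v : Y, (∀ i, |f i v| < d) → ∃ z ∈ Z, ‖v - z‖ ≤ η := by
  have hclosed : IsClosed (Z : Set Y) := hZ.1
  have hfin : FiniteDimensional ℝ (Y ⧸ Z) := hZ.2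
  let b := Module.finBasis ℝ (Y ⧸ Z)
  choose w hw using fun i => Z.mkQ_surjective (b i)
  set M : ℝ := ∑ i, ‖w i‖
  have hM : 0 ≤ M := Finset.sum_nonneg fun i _ => norm_nonneg _
  refine ⟨_, fun i => (LinearMap.toContinuousLinearMap (b.coord i)).comp Z.mkQL,
    η / (M + 1), by positivity, fun v hv => ?_⟩
  have hv' : ∀ i, |b.repr (Z.mkQ v) i| < η / (M + 1) := hv
  refine ⟨v - ∑ i, b.repr (Z.mkQ v) i • w i, ?_, ?_⟩
  · refine (Submodule.Quotient.mk_eq_zero Z).1 ?_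
    rw [← Submodule.mkQ_apply, map_sub, map_sum]
    simp only [map_smul, hw]
    rw [b.sum_repr, sub_self]
  · rw [sub_sub_cancel]
    calc ‖∑ i, b.repr (Z.mkQ v) i • w i‖
        ≤ ∑ i, η / (M + 1) * ‖w i‖ := norm_sum_le_of_le _ fun i _ => by
          rw [norm_smul, Real.norm_eq_abs]
          exact mul_le_mul_of_nonneg_right (hv' i).le (norm_nonneg _)
      _ = η / (M + 1) * M := by rw [← Finset.mul_sum]
      _ ≤ η := by
          rw [div_mul_eq_mul_div, div_le_iff₀ (by positivity)]
          nlinarith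

theorem weaklyOpen_setOf_abs_sub_lt {Y : Type*} [NormedAddCommGroup Y] [NormedSpace ℝ Y]
    {k : ℕ} (f : Fin k → (Y →L[ℝ] ℝ)) (y : Y) {d : ℝ} (hd : 0 < d) :
    WeaklyOpen {x : Y | ∀ i, |f i x - f i y| < d} := by
  intro p hp
  have hp' : ‖(fun i => f i p - f i y)‖ < d := (pi_norm_lt_iff hd).2 hp
  refine ⟨k, f, d - ‖(fun i => f i p - f i y)‖, sub_pos.2 hp', fun x hx i => ?_⟩
  have h₁ : |f i p - f i y| ≤ _ := norm_le_pi_norm (fun i => f i p - f i y) i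
  have h₂ := hx i
  have h₃ := abs_sub_le (f i x) (f i p) (f i y)
  linarith

section

variable {Y : Type*} [NormedAddCommGroup Y] [NormedSpace ℝ Y]

theorem neg_one_mem_lowerBounds_sphere_shift (t : ℝ) (y : Y) (Z : Subspace ℝ Y) :
    -1 ∈ lowerBounds {r | ∃ z ∈ Z, ‖z‖ = 1 ∧ r = ‖y + t • z‖ - 1} := by
  rintro _ ⟨z, -, -, rfl⟩
  linarith [norm_nonneg (y + t • z)]

theorem sInf_sphere_shift_le {t : ℝ} (ht : 0 ≤ t) {y : Y} (hy : ‖y‖ = 1) (Z : Subspace ℝ Y) :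
    sInf {r | ∃ z ∈ Z, ‖z‖ = 1 ∧ r = ‖y + t • z‖ - 1} ≤ t := by
  by_cases h : ∃ z ∈ Z, ‖z‖ = 1
  · obtain ⟨z, hz, hz1⟩ := h
    refine (csInf_le ⟨-1, neg_one_mem_lowerBounds_sphere_shift t y Z⟩ ⟨z, hz, hz1, rfl⟩).trans ?_
    have := norm_add_le y (t • z)
    rw [norm_smul, hz1, hy, Real.norm_of_nonneg ht] at this
    linarith
  · refine (Real.sInf_nonpos ?_).trans ht
    rintro _ ⟨z, hz, hz1, -⟩
    exact (h ⟨z, hz, hz1⟩).elim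

theorem finCodim_top : FinCodim (⊤ : Subspace ℝ Y) :=
  ⟨isClosed_univ, inferInstance⟩

theorem deltaAt_le {t : ℝ} (ht : 0 ≤ t) {y : Y} (hy : ‖y‖ = 1) : deltaAt t y ≤ t := by
  refine Real.sSup_le ?_ ht
  rintro _ ⟨Z, -, rfl⟩
  exact sInf_sphere_shift_le ht hy Z

theorem neg_one_le_deltaAt {t : ℝ} (ht : 0 ≤ t) {y : Y} (hy : ‖y‖ = 1) : -1 ≤ deltaAt t y := by
  refine le_csSup_of_le ⟨t, ?_⟩ ⟨⊤, finCodim_top, rfl⟩ ?_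
  · rintro _ ⟨Z, -, rfl⟩
    exact sInf_sphere_shift_le ht hy Z
  · exact Real.le_sInf (neg_one_mem_lowerBounds_sphere_shift t y ⊤) (by norm_num)

theorem deltaMod_le_deltaAt {t : ℝ} (ht : 0 ≤ t) {y : Y} (hy : ‖y‖ = 1) :
    deltaMod Y t ≤ deltaAt t y := by
  refine csInf_le ⟨-1, ?_⟩ ⟨y, hy, rfl⟩
  rintro _ ⟨x, hx, rfl⟩
  exact neg_one_le_deltaAt ht hx

theorem exists_finCodim_of_lt_deltaAt {t a : ℝ} {y : Y} (ha : a < deltaAt t y) :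
    ∃ Z : Subspace ℝ Y, FinCodim Z ∧ ∀ z ∈ Z, ‖z‖ = 1 → 1 + a ≤ ‖y + t • z‖ := by
  obtain ⟨_, ⟨Z, hZ, rfl⟩, hlt⟩ := exists_lt_of_lt_csSup (by exact ⟨_, ⊤, finCodim_top, rfl⟩) ha
  refine ⟨Z, hZ, fun z hz hz1 => ?_⟩
  have := hlt.trans_le
    (csInf_le ⟨-1, neg_one_mem_lowerBounds_sphere_shift t y Z⟩ ⟨z, hz, hz1, rfl⟩)
  linarith

/-- By convexity, a norm increase in the direction `z` persists at larger distances. -/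
theorem le_norm_add_smul_of_le {y z : Y} (hy : ‖y‖ = 1) {s t a : ℝ} (ht : 0 < t) (ha : 0 ≤ a)
    (hts : t ≤ s) (h : 1 + a ≤ ‖y + t • z‖) : 1 + a ≤ ‖y + s • z‖ := by
  have hs : 0 < s := ht.trans_le hts
  have hl : t / s ≤ 1 := (div_le_one hs).2 hts
  have hl0 : 0 < t / s := div_pos ht hs
  have e : y + t • z = (1 - t / s) • y + (t / s) • (y + s • z) := by
    rw [smul_add, smul_smul, div_mul_cancel₀ _ hs.ne', sub_smul, one_smul]
    abel
  have := norm_add_le ((1 - t / s) • y) ((t / s) • (y + s • z))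
  rw [← e, norm_smul, norm_smul, hy, Real.norm_of_nonneg (sub_nonneg.2 hl),
    Real.norm_of_nonneg hl0.le] at this
  by_contra! hlt
  nlinarith

end

open Pointwise in
/-- inclusion (8) in the proof of Corollary `g_cor`. -/
theorem stmt16 {Y : Type*} [NormedAddCommGroup Y] [NormedSpace ℝ Y] [CompleteSpace Y]
    [TopologicalSpace.SeparableSpace (StrongDual ℝ Y)] :
    ∀ ε : ℝ, 0 < ε → ∀ r : ℝ, 0 < r → r ≤ 1 →
      sigmaPrime ε (closedBall (0 : Y) r) ⊆
        (1 - (1 / 2) * deltaMod Y (ε / 2)) • closedBall (0 : Y) r := by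
  intro ε hε r hr hr1 y hy
  rcases eq_or_ne y 0 with rfl | hy0
  · exact ⟨0, mem_closedBall_self hr.le, smul_zero _⟩
  obtain ⟨hyF, hyV⟩ := hy
  have hyr : ‖y‖ ≤ r := mem_closedBall_zero_iff.1 hyF
  have hn : 0 < ‖y‖ := norm_pos_iff.2 hy0
  have diam_gt : ∀ U : Set Y, WeaklyOpen U → y ∈ U → ε < diam (U ∩ closedBall (0 : Y) r) :=
    fun U hU hyU => not_le.1 fun h => hyV ⟨_, ⟨⟨U, hU, rfl⟩, h⟩, hyU, hyF⟩
  have hεr : ε < 2 * r := by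
    have := diam_gt univ (fun _ _ => ⟨0, Fin.elim0, 1, one_pos, subset_univ _⟩) (mem_univ y)
    rw [univ_inter] at this
    exact this.trans_le (diam_closedBall hr.le)
  set t := ε / 2 with ht
  set δ := deltaMod Y t with hδ
  have ht0 : 0 < t := by positivity
  set u := ‖y‖⁻¹ • y
  have hu : ‖u‖ = 1 := by
    rw [norm_smul, norm_inv, norm_norm, inv_mul_cancel₀ hn.ne']
  have hyu : y = ‖y‖ • u := (smul_inv_smul₀ hn.ne' y).symm
  have hδu : δ ≤ deltaAt t u := deltaMod_le_deltaAt ht0.le hu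
  have hδ1 : δ < 1 := by linarith [deltaAt_le ht0.le hu]
  have hc : 0 < 1 - 1 / 2 * δ := by linarith
  rw [smul_closedBall _ _ hr.le, smul_zero, mem_closedBall_zero_iff, Real.norm_of_nonneg hc.le]
  by_contra! hlt
  have hδ0 : 0 < δ := by nlinarith
  have hgap : r < ‖y‖ * (1 + δ) := by nlinarith [mul_pos hr hδ0]
  obtain ⟨η, hη, hη'⟩ := exists_between
    (show 0 < min (min (t / 2) (δ / 2)) ((‖y‖ * (1 + δ) - r) / 4) from
      lt_min (lt_min (by positivity) (by positivity)) (by linarith))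
  obtain ⟨⟨hηt, hηδ⟩, hηg⟩ := (lt_min_iff.1 hη').imp_left lt_min_iff.1
  obtain ⟨Z, hZ, hZu⟩ := exists_finCodim_of_lt_deltaAt (show δ - η < deltaAt t u by linarith)
  obtain ⟨k, f, d, hd, hf⟩ := hZ.exists_functionals_near hη
  have hZu' : ∀ z ∈ Z, ‖z‖ = 1 → 1 + (δ - 2 * η) ≤ ‖u + (t - η) • z‖ := fun z hz hz1 => by
    have h₁ := hZu z hz hz1
    have h₂ := norm_add_le (u + (t - η) • z) (η • z)
    rw [add_assoc, ← add_smul, sub_add_cancel, norm_smul, hz1, Real.norm_of_nonneg hη.le] at h₂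
    linarith
  have near : ∀ x ∈ {x : Y | ∀ i, |f i x - f i y| < d} ∩ closedBall (0 : Y) r,
      ‖x - y‖ ≤ t := by
    rintro x ⟨hxU, hxr⟩
    rw [mem_closedBall_zero_iff] at hxr
    obtain ⟨z, hz, hze⟩ := hf (x - y) fun i => by rw [map_sub]; exact hxU i
    have htri := norm_sub_norm_le (x - y) z
    by_contra! hxy
    have hzt : t - η < ‖z‖ := by linarith
    have hz0 : 0 < ‖z‖ := by linarith
    have hs : t - η ≤ ‖z‖ / ‖y‖ := hzt.le.trans (le_div_self hz0.le hn (hyr.trans hr1))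
    have hz1 : ‖‖z‖⁻¹ • z‖ = 1 := by
      rw [norm_smul, norm_inv, norm_norm, inv_mul_cancel₀ hz0.ne']
    have hbig := le_norm_add_smul_of_le hu (by linarith) (by linarith) hs
      (hZu' (‖z‖⁻¹ • z) (Z.smul_mem _ hz) hz1)
    have hyz : y + z = ‖y‖ • (u + (‖z‖ / ‖y‖) • ‖z‖⁻¹ • z) := by
      rw [smul_add, ← hyu, smul_smul, smul_smul, mul_div_cancel₀ _ hn.ne',
        mul_inv_cancel₀ hz0.ne', one_smul]
    have hnyz : ‖y‖ * (1 + (δ - 2 * η)) ≤ ‖y + z‖ := by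
      rw [hyz, norm_smul, norm_norm]
      gcongr
    have h₃ := norm_sub_le x (x - y - z)
    rw [show x - (x - y - z) = y + z by abel] at h₃
    nlinarith
  refine (diam_gt _ (weaklyOpen_setOf_abs_sub_lt f y hd) (by simpa using fun _ => hd)).not_ge
    (diam_le_of_forall_dist_le hε.le fun x hx x' hx' => ?_)
  have h₁ := dist_triangle_right x x' y
  rw [dist_eq_norm x y, dist_eq_norm x' y] at h₁
  linarith [near x hx, near x' hx']

end
end
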